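/- Let S be a bounded operator from L^p(X) to L^∞(X) with p < ∞ on a σ-finite measure space X. Then S is an integral operator, i.e., it has a kernel K_S ∈ L¹_loc(X×X) with Sf(x) = ∫ K_S(x,y)f(y) dy for a.e. x, and ‖S‖_{p,∞} = esssup_x ‖K_S(x,·)‖_{p'}, where p' = p/(p−1). -/

import Mathlib

open MeasureTheory
open scoped ENNReal
open Filter Topology

/-- Dominated convergence in `L^p`. -/
theorem tendsto_eLpNorm_sub_of_dominated {X : Type*} [MeasurableSpace X] {μ : Measure X}
    {p : ℝ≥0∞} (hp0 : p ≠ 0) (hp : p ≠ ⊤) {f : ℕ → X → ℝ} {g b : X → ℝ}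
    (hf : ∀ n, AEStronglyMeasurable (f n) μ) (hg : AEStronglyMeasurable g μ) (hb : MemLp b p μ)
    (hbound : ∀ n x, |f n x| ≤ b x) (hlim : ∀ x, Tendsto (fun n => f n x) atTop (𝓝 (g x))) :
    Tendsto (fun n => eLpNorm (f n - g) p μ) atTop (𝓝 0) := by
  have hpr : 0 < p.toReal := ENNReal.toReal_pos hp0 hp
  have hgb : ∀ x, |g x| ≤ b x := fun x =>
    le_of_tendsto (hlim x).abs (Eventually.of_forall fun n => hbound n x)
  have h2b : MemLp (fun x => 2 * b x) p μ := hb.const_mul 2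
  have hfin := lintegral_rpow_enorm_lt_top_of_eLpNorm_lt_top hp0 hp h2b.2
  have key : Tendsto (fun n => ∫⁻ x, ‖(f n - g) x‖ₑ ^ p.toReal ∂μ) atTop
      (𝓝 (∫⁻ _, 0 ∂μ)) := by
    refine tendsto_lintegral_of_dominated_convergence' (fun x => ‖2 * b x‖ₑ ^ p.toReal)
      (fun n => ((hf n).sub hg).enorm.pow_const _) (fun n => Eventually.of_forall fun x => ?_)
      hfin.ne (Eventually.of_forall fun x => ?_)
    · refine ENNReal.rpow_le_rpow ?_ hpr.le
      rw [enorm_le_iff_norm_le]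
      have h0 := abs_nonneg (g x)
      have := hgb x
      have := hbound n x
      rw [Pi.sub_apply, Real.norm_eq_abs, Real.norm_eq_abs,
        abs_of_nonneg (a := 2 * b x) (by linarith)]
      exact (abs_sub _ _).trans (by linarith)
    · have h : Tendsto (fun n => ‖(f n - g) x‖ₑ) atTop (𝓝 0) := by
        have := ((hlim x).sub_const (g x)).enorm
        simpa using this
      simpa [hpr] using h.ennrpow_const p.toReal
  have := key.ennrpow_const (1 / p.toReal)
  simp only [lintegral_zero, one_div, inv_pos, hpr, ENNReal.zero_rpow_of_pos] at this
  refine this.congr fun n => ?_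
  rw [eLpNorm_eq_lintegral_rpow_enorm_toReal hp0 hp, one_div]

theorem abs_indicator_one_le {Z : Type*} (E : Set Z) (z : Z) :
    |E.indicator (1 : Z → ℝ) z| ≤ 1 := by
  by_cases hz : z ∈ E <;> simp [hz]

/-- Induction principle for bounded measurable functions: a property which holds for indicators and
is stable under linear combinations and bounded pointwise limits holds for all of them. -/
theorem bounded_measurable_induction {Z : Type*} [MeasurableSpace Z] {P : (Z → ℝ) → Prop}
    (hind : ∀ E : Set Z, MeasurableSet E → P (E.indicator 1))
    (hadd : ∀ (f g : Z → ℝ) (c d : ℝ), Measurable f → Measurable g → (∀ z, |f z| ≤ c) →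
      (∀ z, |g z| ≤ d) → P f → P g → P (f + g))
    (hsmul : ∀ (a : ℝ) (f : Z → ℝ) (c : ℝ), Measurable f → (∀ z, |f z| ≤ c) → P f → P (a • f))
    (hlim : ∀ (f : ℕ → Z → ℝ) (g : Z → ℝ) (c : ℝ), (∀ n, Measurable (f n)) → Measurable g →
      (∀ n z, |f n z| ≤ c) → (∀ z, Tendsto (fun n => f n z) atTop (𝓝 (g z))) →
      (∀ n, P (f n)) → P g)
    {f : Z → ℝ} {c : ℝ} (hf : Measurable f) (hc : ∀ z, |f z| ≤ c) : P f := by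
  have hsimple : ∀ f : SimpleFunc Z ℝ, P f := fun f => by
    induction f using SimpleFunc.induction with
    | @const a E hE =>
      have h1 : (⇑(SimpleFunc.piecewise E hE (SimpleFunc.const Z a) (SimpleFunc.const Z 0)) :
          Z → ℝ) = a • E.indicator (1 : Z → ℝ) := by
        ext z
        by_cases hz : z ∈ E <;> simp [hz]
      rw [h1]
      exact hsmul a _ 1 (measurable_one.indicator hE) (abs_indicator_one_le E) (hind E hE)
    | @add f g _ hf hg =>
      obtain ⟨c, hc⟩ := f.exists_forall_norm_le
      obtain ⟨d, hd⟩ := g.exists_forall_norm_le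
      exact hadd f g c d f.measurable g.measurable hc hd hf hg
  have hfs := hf.stronglyMeasurable
  have hc' : ∀ z, ‖f z‖ ≤ max c 0 := fun z => (hc z).trans (le_max_left _ _)
  exact hlim _ f (max c 0) (fun n => (hfs.approxBounded (max c 0) n).measurable) hf
    (hfs.norm_approxBounded_le (le_max_right _ _))
    (fun z => hfs.tendsto_approxBounded_of_norm_le (hc' z)) fun n => hsimple _

/-- A functional on bounded measurable functions which is linear, continuous under bounded
pointwise convergence and vanishes on `ρ`-null functions is given by an integrable density. -/
theorem exists_integrable_density {Z : Type*} [MeasurableSpace Z] (ρ : Measure Z) [SigmaFinite ρ]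
    (Ψ : (Z → ℝ) → ℝ)
    (hadd : ∀ (f g : Z → ℝ) (c d : ℝ), Measurable f → Measurable g → (∀ z, |f z| ≤ c) →
      (∀ z, |g z| ≤ d) → Ψ (f + g) = Ψ f + Ψ g)
    (hsmul : ∀ (a : ℝ) (f : Z → ℝ) (c : ℝ), Measurable f → (∀ z, |f z| ≤ c) →
      Ψ (a • f) = a * Ψ f)
    (hlim : ∀ (f : ℕ → Z → ℝ) (g : Z → ℝ) (c : ℝ), (∀ n, Measurable (f n)) → Measurable g →
      (∀ n z, |f n z| ≤ c) → (∀ z, Tendsto (fun n => f n z) atTop (𝓝 (g z))) →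
      Tendsto (fun n => Ψ (f n)) atTop (𝓝 (Ψ g)))
    (hnull : ∀ f : Z → ℝ, f =ᵐ[ρ] 0 → Ψ f = 0) :
    ∃ G : Z → ℝ, Measurable G ∧ Integrable G ρ ∧ ∀ (f : Z → ℝ) (c : ℝ), Measurable f →
      (∀ z, |f z| ≤ c) → Ψ f = ∫ z, f z * G z ∂ρ := by
  classical
  have hind := abs_indicator_one_le (Z := Z)
  have hindm : ∀ {E : Set Z}, MeasurableSet E → Measurable (E.indicator (1 : Z → ℝ)) :=
    fun hE => measurable_one.indicator hE
  have hzero : Ψ (fun _ => 0) = 0 := hnull _ (ae_eq_refl _)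
  let s : SignedMeasure Z :=
    { measureOf' := fun E => if MeasurableSet E then Ψ (E.indicator 1) else 0
      empty' := by simp [hzero]
      not_measurable' := fun E hE => by simp [hE]
      m_iUnion' := fun E hE hd => by
        have hfin : ∀ t : Finset ℕ, ∑ i ∈ t, Ψ ((E i).indicator 1)
            = Ψ ((⋃ i ∈ t, E i).indicator 1) := fun t => by
          induction t using Finset.induction_on with
          | empty => simp [hzero]
          | insert a t ha ih =>
            have hdis : Disjoint (E a) (⋃ i ∈ t, E i) := by
              rw [Set.disjoint_iUnion₂_right]
              exact fun i hi => hd (fun h => ha (h ▸ hi))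
            rw [Finset.sum_insert ha, ih, Finset.set_biUnion_insert,
              Set.indicator_union_of_disjoint hdis]
            exact (hadd _ _ 1 1 (hindm (hE a))
              (hindm (Finset.measurableSet_biUnion t fun i _ => hE i)) (hind _) (hind _)).symm
        simp only [hE, MeasurableSet.iUnion hE, if_true]
        rw [HasSum, SummationFilter.unconditional_filter]
        simp only [hfin]
        refine tendsto_of_seq_tendsto fun u hu => ?_
        refine hlim _ _ 1 (fun n => hindm (Finset.measurableSet_biUnion _ fun i _ => hE i))
          (hindm (MeasurableSet.iUnion hE)) (fun n => hind _) fun z => ?_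
        exact (((tendsto_indicator_biUnion_finset E (1 : Z → ℝ) z).mono_right
          (pure_le_nhds _)).comp hu) }
  have hs : ∀ {E : Set Z}, MeasurableSet E → s E = Ψ (E.indicator 1) := fun hE => if_pos hE
  have hac : s ≪ᵥ ρ.toENNRealVectorMeasure := by
    refine VectorMeasure.AbsolutelyContinuous.mk fun E hE h0 => ?_
    rw [Measure.toENNRealVectorMeasure_apply_measurable hE] at h0
    rw [hs hE]
    exact hnull _ (indicator_meas_zero h0)
  have hrep := SignedMeasure.withDensityᵥ_rnDeriv_eq s ρ hac
  have hG : Integrable (s.rnDeriv ρ) ρ := SignedMeasure.integrable_rnDeriv s ρ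
  refine ⟨s.rnDeriv ρ, SignedMeasure.measurable_rnDeriv s ρ, hG, ?_⟩
  have hset : ∀ E, MeasurableSet E → Ψ (E.indicator 1) = ∫ z in E, s.rnDeriv ρ z ∂ρ :=
    fun E hE => by rw [← hs hE, ← withDensityᵥ_apply hG hE, hrep]
  set G := s.rnDeriv ρ
  have hintg : ∀ (f : Z → ℝ) (c : ℝ), Measurable f → (∀ z, |f z| ≤ c) →
      Integrable (fun z => f z * G z) ρ := fun f c hf hc =>
    hG.bdd_mul hf.aestronglyMeasurable (Eventually.of_forall hc)
  refine fun f c hf hc => bounded_measurable_induction (P := fun f => Ψ f = ∫ z, f z * G z ∂ρ)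
    (fun E hE => ?_) (fun f g c d hf hg hc hd h₁ h₂ => ?_) (fun a f c hf hc h => ?_)
    (fun f g c hf hg hc hfg h => ?_) hf hc
  · rw [hset E hE, ← integral_indicator hE]
    congr 1
    ext z
    by_cases hz : z ∈ E <;> simp [hz]
  · rw [hadd f g c d hf hg hc hd, h₁, h₂, ← integral_add (hintg f c hf hc) (hintg g d hg hd)]
    simp only [Pi.add_apply, add_mul]
  · rw [hsmul a f c hf hc, h, ← integral_const_mul]
    simp only [Pi.smul_apply, smul_eq_mul, mul_assoc]
  · refine tendsto_nhds_unique (hlim f g c hf hg hc hfg) ?_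
    simp only [h]
    refine tendsto_integral_of_dominated_convergence (fun z => c * |G z|)
      (fun n => (hintg _ c (hf n) (hc n)).aestronglyMeasurable)
      (hG.abs.const_mul c) (fun n => Eventually.of_forall fun z => ?_)
      (Eventually.of_forall fun z => (hfg z).mul_const _)
    rw [Real.norm_eq_abs, abs_mul]
    exact mul_le_mul_of_nonneg_right (hc n z) (abs_nonneg _)

section LpSection

variable {X Y : Type*} [MeasurableSpace Y] {μ : Measure Y} {p : ℝ≥0∞}
  {w : Y → ℝ} {H H' : X × Y → ℝ} {c c' : ℝ}

open Classical in
/-- The section `y ↦ H (x, y) * w y` as an element of `L^p`, or `0` if it is not in `L^p`. -/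
noncomputable def lpSection (p : ℝ≥0∞) (μ : Measure Y) (w : Y → ℝ) (H : X × Y → ℝ) (x : X) :
    Lp ℝ p μ :=
  if h : MemLp (fun y => H (x, y) * w y) p μ then h.toLp _ else 0

theorem lpSection_eq {x : X} {g : Y → ℝ} (hg : MemLp g p μ)
    (h : (fun y => H (x, y) * w y) = g) : lpSection p μ w H x = hg.toLp g := by
  subst h
  exact dif_pos hg

theorem lpSection_eq_zero {x : X} (h : (fun y => H (x, y)) =ᵐ[μ] 0) :
    lpSection p μ w H x = 0 := by
  by_cases hm : MemLp (fun y => H (x, y) * w y) p μ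
  · rw [lpSection_eq hm rfl, Lp.eq_zero_iff_ae_eq_zero]
    filter_upwards [hm.coeFn_toLp, h] with y hy hy'
    rw [hy, hy']
    simp
  · exact dif_neg hm

theorem norm_lpSection {x : X} (h : MemLp (fun y => H (x, y) * w y) p μ) :
    ‖lpSection p μ w H x‖ = (eLpNorm (fun y => H (x, y) * w y) p μ).toReal := by
  rw [lpSection_eq h rfl, Lp.norm_toLp]

theorem lpSection_prod {b : Y → ℝ} (A : Set X) (hb : MemLp (fun y => b y * w y) p μ) :
    lpSection p μ w (fun z : X × Y => A.indicator 1 z.1 * b z.2) =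
      A.indicator fun _ => hb.toLp _ := by
  ext1 x
  by_cases hx : x ∈ A
  · rw [Set.indicator_of_mem hx]
    exact lpSection_eq hb (by simp [hx])
  · rw [Set.indicator_of_notMem hx]
    refine lpSection_eq_zero (Eventually.of_forall fun y => ?_)
    simp [hx]

variable [MeasurableSpace X]

theorem memLp_section (hw : MemLp w p μ) (hH : Measurable H) (hc : ∀ z, |H z| ≤ c) (x : X) :
    MemLp (fun y => H (x, y) * w y) p μ := by
  refine hw.of_le_mul (c := c)
    ((hH.comp measurable_prodMk_left).aestronglyMeasurable.mul hw.1) (Eventually.of_forall ?_)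
  intro y
  rw [norm_mul]
  exact mul_le_mul_of_nonneg_right (hc _) (norm_nonneg _)

theorem lpSection_add (hw : MemLp w p μ) (hH : Measurable H) (hc : ∀ z, |H z| ≤ c)
    (hH' : Measurable H') (hc' : ∀ z, |H' z| ≤ c') :
    lpSection p μ w (H + H') = lpSection p μ w H + lpSection p μ w H' := by
  ext1 x
  have h := memLp_section hw hH hc x
  have h' := memLp_section hw hH' hc' x
  rw [Pi.add_apply, lpSection_eq h rfl, lpSection_eq h' rfl, ← MemLp.toLp_add h h']
  refine lpSection_eq (h.add h') ?_
  ext y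
  simp [add_mul]

theorem lpSection_smul (hw : MemLp w p μ) (hH : Measurable H) (hc : ∀ z, |H z| ≤ c) (a : ℝ) :
    lpSection p μ w (a • H) = a • lpSection p μ w H := by
  ext1 x
  have h := memLp_section hw hH hc x
  rw [Pi.smul_apply, lpSection_eq h rfl, ← MemLp.toLp_const_smul a h]
  refine lpSection_eq (h.const_smul a) ?_
  ext y
  simp [mul_assoc]

theorem norm_lpSection_le (hw : MemLp w p μ) (hH : Measurable H) (hc : ∀ z, |H z| ≤ c) (x : X) :
    ‖lpSection p μ w H x‖ ≤ max c 0 * (eLpNorm w p μ).toReal := by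
  rw [norm_lpSection (memLp_section hw hH hc x)]
  refine ENNReal.toReal_le_of_le_ofReal (by positivity) ?_
  rw [ENNReal.ofReal_mul (le_max_right _ _), ENNReal.ofReal_toReal hw.2.ne]
  refine eLpNorm_le_mul_eLpNorm_of_ae_le_mul (Eventually.of_forall fun y => ?_) p
  rw [norm_mul]
  exact mul_le_mul_of_nonneg_right ((hc _).trans (le_max_left _ _)) (norm_nonneg _)

theorem tendsto_lpSection [Fact (1 ≤ p)] (hp : p ≠ ⊤) (hw : MemLp w p μ) {F : ℕ → X × Y → ℝ}
    (hF : ∀ n, Measurable (F n)) (hH : Measurable H) (hc : ∀ n z, |F n z| ≤ c)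
    (hlim : ∀ z, Tendsto (fun n => F n z) atTop (𝓝 (H z))) (x : X) :
    Tendsto (fun n => lpSection p μ w (F n) x) atTop (𝓝 (lpSection p μ w H x)) := by
  have hcH : ∀ z, |H z| ≤ c := fun z =>
    le_of_tendsto (hlim z).abs (Eventually.of_forall fun n => hc n z)
  have h := memLp_section hw hH hcH x
  have hn := fun n => memLp_section hw (hF n) (hc n) x
  rw [lpSection_eq h rfl]
  simp only [fun n => lpSection_eq (hn n) rfl]
  rw [Lp.tendsto_Lp_iff_tendsto_eLpNorm'']
  refine tendsto_eLpNorm_sub_of_dominated (b := fun y => c * |w y|)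
    (zero_lt_one.trans_le (Fact.out : 1 ≤ p)).ne' hp (fun n => (hn n).1) h.1
    (hw.abs.const_mul c) (fun n y => ?_) fun y => (hlim (x, y)).mul_const _
  rw [abs_mul]
  exact mul_le_mul_of_nonneg_right (hc n _) (abs_nonneg _)

theorem stronglyMeasurable_lpSection_indicator [Fact (1 ≤ p)] (hp : p ≠ ⊤) (hw : MemLp w p μ)
    {E : Set (X × Y)} (hE : MeasurableSet E) :
    StronglyMeasurable (lpSection p μ w (E.indicator 1)) := by
  have hm : ∀ {E : Set (X × Y)}, MeasurableSet E → Measurable (E.indicator (1 : X × Y → ℝ)) :=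
    fun hE => measurable_one.indicator hE
  induction E, hE using MeasurableSpace.induction_on_inter generateFrom_prod.symm
    isPiSystem_prod with
  | empty =>
    convert stronglyMeasurable_zero using 1
    ext1 x
    exact lpSection_eq_zero (Eventually.of_forall fun y => by simp)
  | basic E hE =>
    obtain ⟨A, hA, B, hB, rfl⟩ := hE
    have hbw : MemLp (fun y => B.indicator (1 : Y → ℝ) y * w y) p μ := by
      convert hw.indicator hB using 1
      ext y
      by_cases hy : y ∈ B <;> simp [hy]
    have heq : ((A ×ˢ B).indicator 1 : X × Y → ℝ) =
        fun z => A.indicator 1 z.1 * B.indicator 1 z.2 := by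
      ext z
      by_cases h1 : z.1 ∈ A <;> by_cases h2 : z.2 ∈ B <;> simp [Set.indicator, h1, h2]
    rw [heq, lpSection_prod A hbw]
    exact stronglyMeasurable_const.indicator hA
  | compl E hE ih =>
    have hone : lpSection p μ w (1 : X × Y → ℝ) = fun _ => hw.toLp w := by
      ext1 x
      exact lpSection_eq hw (by simp)
    have hsum := lpSection_add hw (hm hE) (abs_indicator_one_le E) (hm hE.compl)
      (abs_indicator_one_le Eᶜ)
    rw [Set.indicator_self_add_compl, hone] at hsum
    rw [← sub_eq_iff_eq_add'.mpr hsum]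
    exact stronglyMeasurable_const.sub ih
  | iUnion E hd hE ih =>
    have hU : ∀ n, MeasurableSet (⋃ i ∈ Finset.range n, E i) := fun n =>
      Finset.measurableSet_biUnion _ fun i _ => hE i
    have hfin : ∀ n, StronglyMeasurable
        (lpSection p μ w ((⋃ i ∈ Finset.range n, E i).indicator 1)) := fun n => by
      induction n with
      | zero =>
        convert stronglyMeasurable_zero using 1
        ext1 x
        exact lpSection_eq_zero (Eventually.of_forall fun y => by simp)
      | succ n ihn =>
        have hdis : Disjoint (E n) (⋃ i ∈ Finset.range n, E i) := by
          rw [Set.disjoint_iUnion₂_right]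
          exact fun i hi => hd (Finset.mem_range.mp hi).ne'
        rw [Finset.range_add_one, Finset.set_biUnion_insert,
          Set.indicator_union_of_disjoint hdis]
        change StronglyMeasurable (lpSection p μ w (_ + _))
        rw [lpSection_add hw (hm (hE n)) (abs_indicator_one_le _) (hm (hU n))
          (abs_indicator_one_le _)]
        exact (ih n).add ihn
    refine stronglyMeasurable_of_tendsto atTop hfin (tendsto_pi_nhds.mpr ?_)
    refine tendsto_lpSection hp hw (fun n => hm (hU n)) (hm (MeasurableSet.iUnion hE))
      (fun n => abs_indicator_one_le _) fun z => ?_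
    exact ((tendsto_indicator_biUnion_finset E (1 : X × Y → ℝ) z).mono_right
      (pure_le_nhds _)).comp tendsto_finset_range

theorem stronglyMeasurable_lpSection [Fact (1 ≤ p)] (hp : p ≠ ⊤) (hw : MemLp w p μ)
    (hH : Measurable H) (hc : ∀ z, |H z| ≤ c) : StronglyMeasurable (lpSection p μ w H) :=
  bounded_measurable_induction (P := fun H => StronglyMeasurable (lpSection p μ w H))
    (fun _ hE => stronglyMeasurable_lpSection_indicator hp hw hE)
    (fun _ _ _ _ hf hg hc hd h₁ h₂ => by
      rw [lpSection_add hw hf hc hg hd]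
      exact h₁.add h₂)
    (fun a _ _ hf hc h => by
      rw [lpSection_smul hw hf hc]
      exact h.const_smul a)
    (fun _ _ _ hf hg hc hlim h => stronglyMeasurable_of_tendsto atTop h
      (tendsto_pi_nhds.mpr (tendsto_lpSection hp hw hf hg hc hlim)))
    hH hc

end LpSection

section Pairing

variable {X Y : Type*} [MeasurableSpace X] [MeasurableSpace Y] {κ ν : Measure X} {μ : Measure Y}
  [IsFiniteMeasure ν] {p : ℝ≥0∞}

theorem ae_norm_le_norm_Lp_top (g : Lp ℝ ⊤ κ) : ∀ᵐ x ∂κ, ‖g x‖ ≤ ‖g‖ := by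
  filter_upwards [ae_le_eLpNormEssSup (f := (g : X → ℝ)) (μ := κ)] with x hx
  rw [Lp.norm_def, eLpNorm_exponent_top]
  rw [← ofReal_norm] at hx
  exact (ENNReal.ofReal_le_iff_le_toReal (by simpa using Lp.eLpNorm_ne_top g)).mp hx

theorem integrable_Lp_top_of_ac (hν : ν ≪ κ) (g : Lp ℝ ⊤ κ) : Integrable g ν :=
  Integrable.of_bound ((Lp.aestronglyMeasurable g).mono_ac hν) ‖g‖
    (hν.ae_le (ae_norm_le_norm_Lp_top g))

/-- Integration over a set against a finite measure, as a functional on `L^∞`. -/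
noncomputable def setIntegralLpTop (hν : ν ≪ κ) (A : Set X) : Lp ℝ ⊤ κ →L[ℝ] ℝ :=
  LinearMap.mkContinuous
    { toFun := fun g => ∫ x in A, g x ∂ν
      map_add' := fun f g => by
        rw [← integral_add (integrable_Lp_top_of_ac hν f).integrableOn
          (integrable_Lp_top_of_ac hν g).integrableOn]
        exact integral_congr_ae (ae_restrict_of_ae (hν.ae_le (Lp.coeFn_add f g)))
      map_smul' := fun a g => by
        rw [RingHom.id_apply, smul_eq_mul, ← integral_const_mul]
        exact integral_congr_ae (ae_restrict_of_ae (hν.ae_le (Lp.coeFn_smul a g))) }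
    (ν.real A) fun g => by
      rw [mul_comm]
      exact norm_setIntegral_le_of_norm_le_const_ae (measure_lt_top ν A)
        (ae_restrict_of_ae (hν.ae_le (ae_norm_le_norm_Lp_top g)))

theorem setIntegralLpTop_apply (hν : ν ≪ κ) (A : Set X) (g : Lp ℝ ⊤ κ) :
    setIntegralLpTop hν A g = ∫ x in A, g x ∂ν := rfl

theorem norm_setIntegralLpTop_le (hν : ν ≪ κ) (A : Set X) :
    ‖setIntegralLpTop hν A‖ ≤ ν.real A :=
  LinearMap.mkContinuous_norm_le _ measureReal_nonneg _

variable [Fact (1 ≤ p)]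

theorem dominatedFinMeasAdditive_setIntegralLpTop_comp (hν : ν ≪ κ)
    (T : Lp ℝ p μ →L[ℝ] Lp ℝ ⊤ κ) :
    DominatedFinMeasAdditive ν (fun A => (setIntegralLpTop hν A).comp T) ‖T‖ := by
  refine ⟨fun A B _ hB _ _ hAB => ?_, fun A _ _ => ?_⟩
  · ext f
    simp only [ContinuousLinearMap.comp_apply, add_apply,
      setIntegralLpTop_apply]
    exact setIntegral_union hAB hB (integrable_Lp_top_of_ac hν _).integrableOn
      (integrable_Lp_top_of_ac hν _).integrableOn
  · rw [mul_comm]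
    exact (ContinuousLinearMap.opNorm_comp_le _ _).trans
      (mul_le_mul_of_nonneg_right (norm_setIntegralLpTop_le hν A) (norm_nonneg _))

theorem integral_prod_indicator_fst [SigmaFinite μ] {F : X × Y → ℝ}
    (hF : Integrable F (ν.prod μ)) {A : Set X} (hA : MeasurableSet A) :
    ∫ z, A.indicator (1 : X → ℝ) z.1 * F z ∂ν.prod μ = ∫ x in A, ∫ y, F (x, y) ∂μ ∂ν := by
  have hintg : Integrable (fun z : X × Y => A.indicator (1 : X → ℝ) z.1 * F z) (ν.prod μ) :=
    hF.bdd_mul ((measurable_one.indicator hA).comp measurable_fst).aestronglyMeasurable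
      (Eventually.of_forall fun z => abs_indicator_one_le A z.1)
  rw [integral_prod _ hintg, ← integral_indicator hA]
  congr 1
  ext x
  by_cases hx : x ∈ A <;> simp [hx]

theorem exists_kernel [SigmaFinite μ] (hp : p ≠ ⊤) (hν : ν ≪ κ) {w : Y → ℝ}
    (hw : MemLp w p μ) (hwm : Measurable w) (hw0 : ∀ y, 0 < w y) (T : Lp ℝ p μ →L[ℝ] Lp ℝ ⊤ κ) :
    ∃ K : X → Y → ℝ, Measurable (Function.uncurry K) ∧
      (∀ᵐ x ∂ν, Integrable (fun y => K x y * w y) μ) ∧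
      (∀ (b : Y → ℝ) (c : ℝ), Measurable b → (∀ y, |b y| ≤ c) →
        ∀ hb : MemLp (fun y => b y * w y) p μ,
          ∀ᵐ x ∂ν, T (hb.toLp _) x = ∫ y, K x y * (b y * w y) ∂μ) ∧
      ∀ (H : X × Y → ℝ) (c : ℝ), Measurable H → (∀ z, |H z| ≤ c) →
        ∀ᵐ x ∂ν, ∫ y, K x y * (H (x, y) * w y) ∂μ ≤
          ‖T‖ * (eLpNorm (fun y => H (x, y) * w y) p μ).toReal := by
  have hT := dominatedFinMeasAdditive_setIntegralLpTop_comp hν T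
  have hintg : ∀ {H : X × Y → ℝ} {c : ℝ}, Measurable H → (∀ z, |H z| ≤ c) →
      Integrable (lpSection p μ w H) ν := fun hH hc =>
    Integrable.of_bound (stronglyMeasurable_lpSection hp hw hH hc).aestronglyMeasurable _
      (Eventually.of_forall (norm_lpSection_le hw hH hc))
  obtain ⟨G, hGm, hGi, hG⟩ := exists_integrable_density (ν.prod μ)
    (fun H => setToFun ν _ hT (lpSection p μ w H))
    (fun f g c d hf hg hc hd => by
      rw [lpSection_add hw hf hc hg hd]
      exact setToFun_add hT (hintg hf hc) (hintg hg hd))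
    (fun a f c hf hc => by
      rw [lpSection_smul hw hf hc]
      exact setToFun_smul hT (fun _ _ => by simp) a _)
    (fun f g c hf hg hc hlim => by
      exact tendsto_setToFun_of_dominated_convergence hT _
        (fun n => (stronglyMeasurable_lpSection hp hw (hf n) (hc n)).aestronglyMeasurable)
        (integrable_const _)
        (fun n => Eventually.of_forall (norm_lpSection_le hw (hf n) (hc n)))
        (Eventually.of_forall (tendsto_lpSection hp hw hf hg hc hlim)))
    (fun f hf => by
      rw [← setToFun_zero hT]
      refine setToFun_congr_ae hT ?_
      filter_upwards [Measure.ae_ae_of_ae_prod hf] with x hx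
      exact lpSection_eq_zero hx)
  have hK : ∀ x y (a : ℝ), G (x, y) / w y * (a * w y) = a * G (x, y) := fun x y a => by
    have := (hw0 y).ne'
    field_simp
  have hHG : ∀ {H : X × Y → ℝ} {c : ℝ}, Measurable H → (∀ z, |H z| ≤ c) →
      Integrable (fun z => H z * G z) (ν.prod μ) := fun hH hc =>
    hGi.bdd_mul hH.aestronglyMeasurable (Eventually.of_forall hc)
  have hA : ∀ {H : X × Y → ℝ} {c : ℝ}, Measurable H → (∀ z, |H z| ≤ c) → ∀ {A : Set X},
      MeasurableSet A → setToFun ν _ hT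
        (lpSection p μ w fun z => A.indicator 1 z.1 * H z) =
          ∫ x in A, ∫ y, H (x, y) * G (x, y) ∂μ ∂ν ∧
        Measurable (fun z : X × Y => A.indicator 1 z.1 * H z) ∧
        ∀ z : X × Y, |A.indicator 1 z.1 * H z| ≤ c := fun {H c} hH hc A hA => by
    have hm : Measurable (fun z : X × Y => A.indicator 1 z.1 * H z) :=
      ((measurable_one.indicator hA).comp measurable_fst).mul hH
    have hb : ∀ z : X × Y, |A.indicator 1 z.1 * H z| ≤ c := fun z => by
      rw [abs_mul]
      exact (mul_le_of_le_one_left (abs_nonneg _) (abs_indicator_one_le A z.1)).trans (hc z)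
    refine ⟨?_, hm, hb⟩
    rw [hG _ c hm hb, ← integral_prod_indicator_fst (hHG hH hc) hA]
    simp only [mul_assoc]
  refine ⟨fun x y => G (x, y) / w y, hGm.div (hwm.comp measurable_snd), ?_, ?_, ?_⟩
  · filter_upwards [hGi.prod_right_ae] with x hx
    convert hx using 2 with y
    have := (hw0 y).ne'
    field_simp
  · intro b c hb hc hbw
    simp only [hK]
    have hbm : Measurable fun z : X × Y => b z.2 := hb.comp measurable_snd
    refine Integrable.ae_eq_of_forall_setIntegral_eq _ _ (integrable_Lp_top_of_ac hν _)
      (hHG hbm fun z => hc z.2).integral_prod_left fun A hAm _ => ?_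
    rw [← (hA hbm (fun z => hc z.2) hAm).1, lpSection_prod A hbw,
      setToFun_indicator_const hT hAm (measure_ne_top ν A)]
    rfl
  · intro H c hH hc
    simp only [hK]
    have hnorm : ∀ x, (eLpNorm (fun y => H (x, y) * w y) p μ).toReal =
        ‖lpSection p μ w H x‖ := fun x => (norm_lpSection (memLp_section hw hH hc x)).symm
    simp only [hnorm]
    refine ae_le_of_forall_setIntegral_le (hHG hH hc).integral_prod_left
      ((hintg hH hc).norm.const_mul _) fun A hAm _ => ?_
    obtain ⟨h1, hm, hb⟩ := hA hH hc hAm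
    rw [← h1]
    refine (le_abs_self _).trans ((norm_setToFun_le hT (hintg hm hb) (norm_nonneg _)).trans ?_)
    rw [L1.norm_of_fun_eq_integral_norm, integral_const_mul, ← integral_indicator hAm]
    refine mul_le_mul_of_nonneg_left (integral_mono (hintg hm hb).norm
      ((hintg hH hc).norm.indicator hAm) fun x => ?_) (norm_nonneg _)
    by_cases hx : x ∈ A
    · rw [Set.indicator_of_mem hx, lpSection_eq (memLp_section hw hH hc x) (by simp [hx]),
        lpSection_eq (memLp_section hw hH hc x) rfl]
    · rw [Set.indicator_of_notMem hx,
        lpSection_eq_zero (Eventually.of_forall fun y => by simp [hx]), norm_zero]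

end Pairing

section Duality

variable {Y : Type*} [MeasurableSpace Y] {μ : Measure Y}

/-- The test function detecting where `|k|` exceeds `C`. -/
theorem eLpNorm_top_le_of_test {k w : Y → ℝ} {C : ℝ} (hC : 0 ≤ C) (hk : Measurable k)
    (hw0 : ∀ y, 0 < w y) (hw : MemLp w 1 μ) (hkw : Integrable (fun y => k y * w y) μ)
    (h : ∫ y, k y * ({y | C < |k y|}.indicator (fun y => k y * |k y|⁻¹) y * w y) ∂μ ≤
      C * (eLpNorm (fun y => {y | C < |k y|}.indicator (fun y => k y * |k y|⁻¹) y * w y)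
        1 μ).toReal) :
    eLpNorm k ⊤ μ ≤ ENNReal.ofReal C := by
  set E : Set Y := {y | C < |k y|}
  have hE : MeasurableSet E := measurableSet_lt measurable_const hk.abs
  have hwi : Integrable w μ := memLp_one_iff_integrable.mp hw
  have hk0 : ∀ y ∈ E, 0 < |k y| := fun y hy => hC.trans_lt hy
  have habs : ∀ y, |E.indicator (fun y => k y * |k y|⁻¹) y * w y| = E.indicator w y := fun y => by
    by_cases hy : y ∈ E
    · rw [Set.indicator_of_mem hy, Set.indicator_of_mem hy, abs_mul, abs_mul, abs_inv, abs_abs,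
        mul_inv_cancel₀ (hk0 y hy).ne', one_mul, abs_of_pos (hw0 y)]
    · simp [hy]
  have hmul : ∀ y, k y * (E.indicator (fun y => k y * |k y|⁻¹) y * w y) =
      E.indicator (fun y => |k y| * w y) y := fun y => by
    by_cases hy : y ∈ E
    · have := (hk0 y hy).ne'
      rw [Set.indicator_of_mem hy, Set.indicator_of_mem hy]
      field_simp
      rw [sq_abs]
    · simp [hy]
  have hnorm : (eLpNorm (fun y => E.indicator (fun y => k y * |k y|⁻¹) y * w y) 1 μ).toReal =
      ∫ y, E.indicator w y ∂μ := by
    rw [eLpNorm_one_eq_lintegral_enorm, ← integral_norm_eq_lintegral_enorm]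
    · exact integral_congr_ae (Eventually.of_forall habs)
    · exact ((hk.mul hk.abs.inv).indicator hE).aestronglyMeasurable.mul hw.1
  have hki : Integrable (fun y => |k y| * w y) μ := by
    refine hkw.abs.congr (Eventually.of_forall fun y => ?_)
    simp [abs_mul, abs_of_pos (hw0 y)]
  simp only [hmul, hnorm] at h
  rw [← integral_const_mul, ← sub_nonpos, ← integral_sub (hki.indicator hE)
    ((hwi.indicator hE).const_mul C)] at h
  have hpos : 0 ≤ fun y => E.indicator (fun y => |k y| * w y) y - C * E.indicator w y := fun y => by
    by_cases hy : y ∈ E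
    · simp only [Set.indicator_of_mem hy, Pi.zero_apply, ← sub_mul]
      exact mul_nonneg (sub_nonneg.mpr (le_of_lt hy)) (hw0 y).le
    · simp [hy]
  have hzero := (integral_eq_zero_iff_of_nonneg hpos
    ((hki.indicator hE).sub ((hwi.indicator hE).const_mul C))).mp
      (le_antisymm h (integral_nonneg hpos))
  rw [eLpNorm_exponent_top]
  refine eLpNormEssSup_le_of_ae_bound ?_
  filter_upwards [hzero] with y hy
  by_contra hlt
  have hyE : y ∈ E := not_le.mp hlt
  simp only [Set.indicator_of_mem hyE, Pi.zero_apply, ← sub_mul] at hy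
  exact (mul_pos (sub_pos.mpr hyE) (hw0 y)).ne' hy

theorem abs_mul_abs_rpow_sub_two {q : ℝ} (hq : 0 < q - 1) (a : ℝ) :
    |a * |a| ^ (q - 2)| = |a| ^ (q - 1) := by
  rw [abs_mul, abs_of_nonneg (Real.rpow_nonneg (abs_nonneg a) _)]
  rcases (abs_nonneg a).eq_or_lt' with h0 | h0
  · rw [h0, zero_mul, Real.zero_rpow hq.ne']
  · rw [show q - 1 = 1 + (q - 2) by ring, Real.rpow_add h0, Real.rpow_one]

/-- The test functions are the truncations of `k * |k| ^ (q - 2)`. -/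
theorem eLpNorm_le_of_test {p q : ℝ} (hpq : p.HolderConjugate q) {k w : Y → ℝ} {C : ℝ}
    (hC : 0 ≤ C) (hk : Measurable k) (hw0 : ∀ y, 0 < w y) (hwm : Measurable w)
    (hw : MemLp w (ENNReal.ofReal p) μ)
    (h : ∀ n : ℕ,
      ∫ y, k y * ({y | |k y| ^ (q - 1) ≤ n * w y}.indicator
        (fun y => k y * |k y| ^ (q - 2) / w y) y * w y) ∂μ ≤
      C * (eLpNorm (fun y => {y | |k y| ^ (q - 1) ≤ n * w y}.indicator
        (fun y => k y * |k y| ^ (q - 2) / w y) y * w y) (ENNReal.ofReal p) μ).toReal) :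
    eLpNorm k (ENNReal.ofReal q) μ ≤ ENNReal.ofReal C := by
  have hp0 := hpq.pos
  have hq0 := hpq.symm.pos
  have hq1 : 0 < q - 1 := hpq.symm.sub_one_pos
  set E : ℕ → Set Y := fun n => {y | |k y| ^ (q - 1) ≤ n * w y}
  have hE : ∀ n, MeasurableSet (E n) := fun n =>
    measurableSet_le (hk.abs.pow_const _) (hwm.const_mul _)
  have hbound : ∀ n, ∫⁻ y in E n, ‖k y‖ₑ ^ q ∂μ ≤ ENNReal.ofReal C ^ q := fun n => by
    set g : Y → ℝ := fun y => (E n).indicator (fun y => k y * |k y| ^ (q - 2) / w y) y * w y with hg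
    have hgm : Measurable g :=
      (((hk.mul (hk.abs.pow_const _)).div hwm).indicator (hE n)).mul hwm
    have hgabs : ∀ y, |g y| = (E n).indicator (fun y => |k y| ^ (q - 1)) y := fun y => by
      by_cases hy : y ∈ E n
      · simp only [hg, Set.indicator_of_mem hy]
        rw [div_mul_cancel₀ _ (hw0 y).ne', abs_mul_abs_rpow_sub_two hq1]
      · simp [hg, hy]
    have hgk : ∀ y, k y * g y = (E n).indicator (fun y => |k y| ^ q) y := fun y => by
      by_cases hy : y ∈ E n
      · simp only [hg, Set.indicator_of_mem hy]
        rw [div_mul_cancel₀ _ (hw0 y).ne', ← mul_assoc, ← abs_mul_abs_self]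
        rcases (abs_nonneg (k y)).eq_or_lt' with h0 | h0
        · rw [h0, zero_mul, zero_mul, Real.zero_rpow hq0.ne']
        · rw [show q = 1 + 1 + (q - 2) by ring, Real.rpow_add h0, Real.rpow_add h0, Real.rpow_one]
          ring_nf
      · simp [hg, hy]
    have hgmem : MemLp g (ENNReal.ofReal p) μ := by
      refine hw.of_le_mul (c := n) hgm.aestronglyMeasurable (Eventually.of_forall fun y => ?_)
      rw [Real.norm_eq_abs, hgabs, Real.norm_eq_abs, abs_of_pos (hw0 y)]
      by_cases hy : y ∈ E n
      · rw [Set.indicator_of_mem hy]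
        exact hy
      · rw [Set.indicator_of_notMem hy]
        exact mul_nonneg n.cast_nonneg (hw0 y).le
    have hpow : ∀ y, ‖g y‖ₑ ^ p = (E n).indicator (fun y => ‖k y‖ₑ ^ q) y := fun y => by
      rw [← enorm_norm, Real.norm_eq_abs, hgabs]
      by_cases hy : y ∈ E n
      · rw [Set.indicator_of_mem hy, Set.indicator_of_mem hy,
          Real.enorm_rpow_of_nonneg (abs_nonneg _) hq1.le, ← ENNReal.rpow_mul,
          ← Real.norm_eq_abs, enorm_norm, hpq.symm.sub_one_mul_conj]
      · simp [hy, hp0]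
    set I := ∫⁻ y in E n, ‖k y‖ₑ ^ q ∂μ with hI
    have hIg : ∫⁻ y, ‖g y‖ₑ ^ p ∂μ = I := by
      simp only [hpow]
      exact lintegral_indicator (hE n) _
    have hpne : ENNReal.ofReal p ≠ 0 := by simpa using hp0
    have heL : eLpNorm g (ENNReal.ofReal p) μ = I ^ (1 / p) := by
      rw [eLpNorm_eq_lintegral_rpow_enorm_toReal hpne ENNReal.ofReal_ne_top,
        ENNReal.toReal_ofReal hp0.le, hIg]
    have hIfin : I ≠ ⊤ := by
      have := lintegral_rpow_enorm_lt_top_of_eLpNorm_lt_top hpne ENNReal.ofReal_ne_top hgmem.2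
      rw [ENNReal.toReal_ofReal hp0.le, hIg] at this
      exact this.ne
    have hintg : ∫ y, k y * g y ∂μ = I.toReal := by
      simp only [hgk]
      rw [integral_eq_lintegral_of_nonneg_ae
        (Eventually.of_forall fun y => Set.indicator_nonneg (fun _ _ => by positivity) y)
        ((hk.abs.pow_const q).indicator (hE n)).aestronglyMeasurable, hI,
        ← lintegral_indicator (hE n)]
      congr 2
      ext y
      by_cases hy : y ∈ E n
      · rw [Set.indicator_of_mem hy, Set.indicator_of_mem hy,
          ← ENNReal.ofReal_rpow_of_nonneg (abs_nonneg _) hq0.le, ← Real.norm_eq_abs, ofReal_norm]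
      · simp [hy]
    have hmain := h n
    rw [hintg, heL, ← ENNReal.toReal_rpow] at hmain
    set i := I.toReal with hi
    have hi0 : 0 ≤ i := ENNReal.toReal_nonneg
    have hiq : i ≤ C ^ q := by
      rcases hi0.eq_or_lt' with h0 | h0
      · rw [h0]
        positivity
      · have h1 : i ^ (1 / q) ≤ C := by
          have h2 : i = i ^ (1 / q) * i ^ (1 / p) := by
            rw [← Real.rpow_add h0, one_div, one_div, add_comm, hpq.inv_add_inv_eq_one,
              Real.rpow_one]
          exact le_of_mul_le_mul_right (h2.symm.trans_le hmain) (Real.rpow_pos_of_pos h0 _)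
        calc i = (i ^ (1 / q)) ^ q := by
              rw [← Real.rpow_mul hi0, one_div_mul_cancel hq0.ne', Real.rpow_one]
          _ ≤ C ^ q := Real.rpow_le_rpow (by positivity) h1 hq0.le
    rw [ENNReal.ofReal_rpow_of_nonneg hC hq0.le, ← ENNReal.ofReal_toReal hIfin]
    exact ENNReal.ofReal_le_ofReal hiq
  have hmono : Monotone E := fun m n hmn y hy =>
    le_trans (show _ ≤ (m : ℝ) * w y from hy)
      (mul_le_mul_of_nonneg_right (Nat.cast_le.mpr hmn) (hw0 y).le)
  have hcover : ⋃ n, E n = Set.univ := Set.eq_univ_of_forall fun y => by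
    obtain ⟨n, hn⟩ := exists_nat_ge (|k y| ^ (q - 1) / w y)
    exact Set.mem_iUnion.mpr ⟨n, (div_le_iff₀ (hw0 y)).mp hn⟩
  rw [eLpNorm_eq_lintegral_rpow_enorm_toReal (by simpa using hq0) ENNReal.ofReal_ne_top,
    ENNReal.toReal_ofReal hq0.le, one_div, ENNReal.rpow_inv_le_iff hq0, ← setLIntegral_univ,
    ← hcover, setLIntegral_iUnion_of_directed _ hmono.directed_le]
  exact iSup_le hbound

end Duality

theorem exists_pos_memLp {Y : Type*} [MeasurableSpace Y] (μ : Measure Y) [SigmaFinite μ] {p : ℝ}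
    (hp : 0 < p) :
    ∃ w : Y → ℝ, Measurable w ∧ (∀ y, 0 < w y) ∧ MemLp w (ENNReal.ofReal p) μ := by
  obtain ⟨g, hg0, hgm, hg⟩ := exists_pos_lintegral_lt_of_sigmaFinite μ one_ne_zero
  have hwm : Measurable fun y => (g y : ℝ) ^ (1 / p) := hgm.coe_nnreal_real.pow_const _
  refine ⟨fun y => (g y : ℝ) ^ (1 / p), hwm,
    fun y => Real.rpow_pos_of_pos (NNReal.coe_pos.mpr (hg0 y)) _, hwm.aestronglyMeasurable, ?_⟩
  rw [eLpNorm_lt_top_iff_lintegral_rpow_enorm_lt_top (by simpa using hp) ENNReal.ofReal_ne_top,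
    ENNReal.toReal_ofReal hp.le]
  refine lt_of_eq_of_lt (lintegral_congr fun y => ?_) (hg.trans ENNReal.one_lt_top)
  rw [Real.enorm_rpow_of_nonneg (g y).coe_nonneg (by positivity), ← ENNReal.rpow_mul,
    one_div_mul_cancel hp.ne', ENNReal.rpow_one]
  simp

section Kernel

variable {X Y : Type*} [MeasurableSpace X] [MeasurableSpace Y] {ν : Measure X} {μ : Measure Y}

theorem ae_eLpNorm_kernel_le {p : ℝ} (hp : 1 ≤ p) {p' : ℝ≥0∞}
    [hpp : ENNReal.HolderConjugate (ENNReal.ofReal p) p'] {w : Y → ℝ}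
    (hw : MemLp w (ENNReal.ofReal p) μ) (hwm : Measurable w) (hw0 : ∀ y, 0 < w y)
    {K : X → Y → ℝ} {C : ℝ} (hC : 0 ≤ C) (hK : Measurable (Function.uncurry K))
    (hKw : ∀ᵐ x ∂ν, Integrable (fun y => K x y * w y) μ)
    (h : ∀ (H : X × Y → ℝ) (c : ℝ), Measurable H → (∀ z, |H z| ≤ c) →
      ∀ᵐ x ∂ν, ∫ y, K x y * (H (x, y) * w y) ∂μ ≤
        C * (eLpNorm (fun y => H (x, y) * w y) (ENNReal.ofReal p) μ).toReal) :
    ∀ᵐ x ∂ν, eLpNorm (K x) p' μ ≤ ENNReal.ofReal C := by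
  have hKx : ∀ x, Measurable (K x) := fun x => hK.of_uncurry_left
  rcases hp.eq_or_lt with rfl | hp1
  · have hp' : p' = ⊤ := by
      rw [ENNReal.ofReal_one] at hpp
      exact (ENNReal.HolderConjugate.unique 1 p' ⊤)
    subst hp'
    rw [ENNReal.ofReal_one] at hw
    have hE : MeasurableSet {z : X × Y | C < |Function.uncurry K z|} :=
      measurableSet_lt measurable_const hK.abs
    filter_upwards [hKw, h ({z : X × Y | C < |Function.uncurry K z|}.indicator
      fun z => Function.uncurry K z * |Function.uncurry K z|⁻¹) 1
      ((hK.mul hK.abs.inv).indicator hE) (fun z => by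
        by_cases hz : z ∈ {z : X × Y | C < |Function.uncurry K z|}
        · rw [Set.indicator_of_mem hz, abs_mul, abs_inv, abs_abs]
          exact mul_inv_le_one
        · simp [Set.indicator_of_notMem hz])] with x hx hx'
    rw [ENNReal.ofReal_one] at hx'
    exact eLpNorm_top_le_of_test hC (hKx x) hw0 hw hx hx'
  · obtain ⟨q, hpq, rfl⟩ : ∃ q : ℝ, p.HolderConjugate q ∧ p' = ENNReal.ofReal q := by
      have hpq := Real.HolderConjugate.conjExponent hp1
      have := hpq.ennrealOfReal
      exact ⟨_, hpq, ENNReal.HolderConjugate.unique (ENNReal.ofReal p) _ _⟩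
    have hq1 : 0 < q - 1 := hpq.symm.sub_one_pos
    have hall : ∀ n : ℕ, ∀ᵐ x ∂ν, _ := fun n =>
      h ({z : X × Y | |Function.uncurry K z| ^ (q - 1) ≤ n * w z.2}.indicator
        fun z => Function.uncurry K z * |Function.uncurry K z| ^ (q - 2) / w z.2) n
        (((hK.mul (hK.abs.pow_const _)).div (hwm.comp measurable_snd)).indicator
          (measurableSet_le (hK.abs.pow_const _) ((hwm.comp measurable_snd).const_mul _)))
        (fun z => by
          by_cases hz : z ∈ {z : X × Y | |Function.uncurry K z| ^ (q - 1) ≤ n * w z.2}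
          · rw [Set.indicator_of_mem hz, abs_div, abs_mul_abs_rpow_sub_two hq1,
              abs_of_pos (hw0 z.2), div_le_iff₀ (hw0 z.2)]
            exact hz
          · simp [Set.indicator_of_notMem hz])
    filter_upwards [ae_all_iff.mpr hall] with x hx
    exact eLpNorm_le_of_test hpq hC (hKx x) hw0 hwm hw hx

theorem enorm_integral_mul_le {p p' : ℝ≥0∞} [ENNReal.HolderConjugate p p'] {k f : Y → ℝ}
    (hk : AEStronglyMeasurable k μ) (hf : AEStronglyMeasurable f μ) :
    ‖∫ y, k y * f y ∂μ‖ₑ ≤ eLpNorm k p' μ * eLpNorm f p μ := by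
  have : ENNReal.HolderConjugate p' p := ENNReal.HolderConjugate.symm (p := p) (q := p')
  calc ‖∫ y, k y * f y ∂μ‖ₑ ≤ ∫⁻ y, ‖(k • f) y‖ₑ ∂μ := enorm_integral_le_lintegral_enorm _
    _ = eLpNorm (k • f) 1 μ := eLpNorm_one_eq_lintegral_enorm.symm
    _ ≤ eLpNorm k p' μ * eLpNorm f p μ := eLpNorm_smul_le_mul_eLpNorm (r := 1) hf hk

theorem tendsto_clamp (a : ℝ) :
    Tendsto (fun n : ℕ => max (-(n : ℝ)) (min (n : ℝ) a)) atTop (𝓝 a) := by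
  obtain ⟨N, hN⟩ := exists_nat_ge |a|
  refine tendsto_const_nhds.congr' ?_
  filter_upwards [eventually_ge_atTop N] with n hn
  have h : |a| ≤ n := hN.trans (Nat.cast_le.mpr hn)
  rw [min_eq_right (abs_le.mp h).2, max_eq_right (abs_le.mp h).1]

theorem abs_clamp_le (n : ℕ) (a : ℝ) :
    |max (-(n : ℝ)) (min (n : ℝ) a)| ≤ n ∧ |max (-(n : ℝ)) (min (n : ℝ) a)| ≤ |a| := by
  have hn : (0 : ℝ) ≤ n := n.cast_nonneg
  have h1 := neg_abs_le a
  have h2 := le_abs_self a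
  have h3 := abs_nonneg a
  refine ⟨abs_le.mpr ⟨le_max_left _ _, max_le (by linarith) (min_le_left _ _)⟩,
    abs_le.mpr ⟨?_, max_le (by linarith) ((min_le_right _ _).trans h2)⟩⟩
  rcases le_total (n : ℝ) a with h | h
  · rw [min_eq_left h]
    exact le_max_of_le_right (by linarith)
  · rw [min_eq_right h]
    exact le_max_of_le_right h1

/-- An operator given by a kernel on the bounded multiples of a positive weight is given by the
same kernel on all of `L^p`. -/
theorem ae_eq_integral_kernel {κ : Measure X} (hν : ν ≪ κ) {p p' : ℝ≥0∞} [Fact (1 ≤ p)]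
    (hp : p ≠ ⊤) [ENNReal.HolderConjugate p p'] {w : Y → ℝ} (hwm : Measurable w)
    (hw0 : ∀ y, 0 < w y) {K : X → Y → ℝ} (hK : Measurable (Function.uncurry K))
    (hKp : ∀ᵐ x ∂ν, eLpNorm (K x) p' μ < ⊤) (T : Lp ℝ p μ →L[ℝ] Lp ℝ ⊤ κ)
    (h : ∀ (b : Y → ℝ) (c : ℝ), Measurable b → (∀ y, |b y| ≤ c) →
      ∀ hb : MemLp (fun y => b y * w y) p μ,
        ∀ᵐ x ∂ν, T (hb.toLp _) x = ∫ y, K x y * (b y * w y) ∂μ) (f : Lp ℝ p μ) :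
    ∀ᵐ x ∂ν, T f x = ∫ y, K x y * f y ∂μ := by
  have hsymm : ENNReal.HolderConjugate p' p := ENNReal.HolderConjugate.symm
  have hfm : Measurable f := (Lp.stronglyMeasurable f).measurable
  let b : ℕ → Y → ℝ := fun n y => max (-(n : ℝ)) (min (n : ℝ) (f y / w y))
  have hbm : ∀ n, Measurable (b n) := fun n =>
    measurable_const.max (measurable_const.min (hfm.div hwm))
  have hbf : ∀ n y, |b n y * w y| ≤ |f y| := fun n y => by
    rw [abs_mul, abs_of_pos (hw0 y), ← le_div_iff₀ (hw0 y)]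
    refine (abs_clamp_le n _).2.trans_eq ?_
    rw [abs_div, abs_of_pos (hw0 y)]
  have hblim : ∀ y, Tendsto (fun n => b n y * w y) atTop (𝓝 (f y)) := fun y => by
    have := (tendsto_clamp (f y / w y)).mul_const (w y)
    rwa [div_mul_cancel₀ _ (hw0 y).ne'] at this
  have hbmem : ∀ n, MemLp (fun y => b n y * w y) p μ := fun n =>
    (Lp.memLp f).mono ((hbm n).mul hwm).aestronglyMeasurable (Eventually.of_forall (hbf n))
  have hlim : Tendsto (fun n => (hbmem n).toLp _) atTop (𝓝 f) := by
    conv in 𝓝 f => rw [← Lp.toLp_coeFn f (Lp.memLp f)]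
    rw [Lp.tendsto_Lp_iff_tendsto_eLpNorm'']
    exact tendsto_eLpNorm_sub_of_dominated (zero_lt_one.trans_le (Fact.out : 1 ≤ p)).ne' hp
      (fun n => (hbmem n).1) (Lp.memLp f).1 (Lp.memLp f).abs hbf hblim
  have hTlim : Tendsto (fun n => ‖T ((hbmem n).toLp _) - T f‖) atTop (𝓝 0) :=
    tendsto_iff_norm_sub_tendsto_zero.mp ((T.continuous.tendsto f).comp hlim)
  have hae : ∀ n, ∀ᵐ x ∂ν, ‖T ((hbmem n).toLp _) x - T f x‖ ≤ ‖T ((hbmem n).toLp _) - T f‖ :=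
    fun n => hν.ae_le (by
      filter_upwards [ae_norm_le_norm_Lp_top (T ((hbmem n).toLp _) - T f),
        Lp.coeFn_sub (T ((hbmem n).toLp _)) (T f)] with x h1 h2
      rwa [h2] at h1)
  filter_upwards [hKp, ae_all_iff.mpr hae,
    ae_all_iff.mpr fun n => h (b n) n (hbm n) (fun y => (abs_clamp_le n _).1) (hbmem n)]
    with x hx hx1 hx2
  have hKx : MemLp (K x) p' μ := ⟨hK.of_uncurry_left.aestronglyMeasurable, hx⟩
  refine tendsto_nhds_unique (f := fun n => T ((hbmem n).toLp _) x) (l := atTop) ?_ ?_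
  · exact tendsto_iff_norm_sub_tendsto_zero.mpr
      (squeeze_zero (fun _ => norm_nonneg _) hx1 hTlim)
  · simp only [hx2]
    refine tendsto_integral_of_dominated_convergence (fun y => |K x y * f y|)
      (fun n => hKx.1.mul (hbmem n).1) (hKx.integrable_mul (Lp.memLp f)).abs
      (fun n => Eventually.of_forall fun y => ?_)
      (Eventually.of_forall fun y => (hblim y).const_mul _)
    rw [Real.norm_eq_abs, abs_mul, abs_mul (K x y) (f y)]
    exact mul_le_mul_of_nonneg_left (hbf n y) (abs_nonneg _)

theorem opNorm_le_essSup_kernel {κ : Measure X} {p p' : ℝ≥0∞} [Fact (1 ≤ p)]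
    [ENNReal.HolderConjugate p p'] {K : X → Y → ℝ} (hK : Measurable (Function.uncurry K))
    (T : Lp ℝ p μ →L[ℝ] Lp ℝ ⊤ κ)
    (h : ∀ f : Lp ℝ p μ, ∀ᵐ x ∂κ, T f x = ∫ y, K x y * f y ∂μ) :
    ENNReal.ofReal ‖T‖ ≤ essSup (fun x => eLpNorm (K x) p' μ) κ := by
  set M := essSup (fun x => eLpNorm (K x) p' μ) κ
  rcases eq_or_ne M ⊤ with hM | hM
  · simp [hM]
  refine ENNReal.ofReal_le_of_le_toReal
    (T.opNorm_le_bound ENNReal.toReal_nonneg fun f => ?_)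
  rw [Lp.norm_def, Lp.norm_def, ← ENNReal.toReal_mul]
  refine ENNReal.toReal_mono (ENNReal.mul_ne_top hM (Lp.eLpNorm_ne_top f)) ?_
  rw [eLpNorm_exponent_top]
  refine eLpNormEssSup_le_of_ae_enorm_bound ?_
  filter_upwards [h f, ENNReal.ae_le_essSup fun x => eLpNorm (K x) p' μ] with x hx hx'
  rw [hx]
  exact (enorm_integral_mul_le hK.of_uncurry_left.aestronglyMeasurable
    (Lp.aestronglyMeasurable f)).trans (mul_le_mul_left hx' _)

end Kernel

/-- Gelfand–Dunford–Pettis theorem: a bounded operator `T : L^p(X) → L^∞(X)`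
with `p < ∞` on a σ-finite measure space is an integral operator, and its
operator norm equals the essential supremum of the `L^{p'}` norms of the rows
of its kernel, `p'` being the conjugate exponent of `p`. -/
theorem gelfand_dunford_pettis
    {X : Type*} [MeasurableSpace X] (μ : Measure X) [SigmaFinite μ]
    (p : ℝ) (hp : 1 ≤ p) [Fact (1 ≤ ENNReal.ofReal p)]
    (T : Lp ℝ (ENNReal.ofReal p) μ →L[ℝ] Lp ℝ ⊤ μ)
    (p' : ℝ≥0∞) (hp' : 1 / ENNReal.ofReal p + 1 / p' = 1) :
    ∃ K : X → X → ℝ,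
      Measurable (Function.uncurry K) ∧
      (∀ f : Lp ℝ (ENNReal.ofReal p) μ,
        ∀ᵐ x ∂μ, (T f : X → ℝ) x = ∫ y, K x y * (f : X → ℝ) y ∂μ) ∧
      ENNReal.ofReal ‖T‖ = essSup (fun x => eLpNorm (K x) p' μ) μ := by
  have : ENNReal.HolderConjugate (ENNReal.ofReal p) p' := ⟨by simpa using hp'⟩
  obtain ⟨w, hwm, hw0, hw⟩ := exists_pos_memLp μ (zero_lt_one.trans_le hp)
  obtain ⟨K, hK, hKw, hTK, hKT⟩ := exists_kernel ENNReal.ofReal_ne_top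
    (toFinite_absolutelyContinuous μ) hw hwm hw0 T
  have hnorm := ae_eLpNorm_kernel_le (p' := p') hp hw hwm hw0 (norm_nonneg T) hK hKw hKT
  have hrep : ∀ f : Lp ℝ (ENNReal.ofReal p) μ, ∀ᵐ x ∂μ, T f x = ∫ y, K x y * f y ∂μ := fun f =>
    (absolutelyContinuous_toFinite μ).ae_le <|
      ae_eq_integral_kernel (p' := p') (toFinite_absolutelyContinuous μ) ENNReal.ofReal_ne_top
        hwm hw0 hK (hnorm.mono fun x hx => hx.trans_lt ENNReal.ofReal_lt_top) T hTK f
  exact ⟨K, hK, hrep, le_antisymm (opNorm_le_essSup_kernel hK T hrep)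
    (essSup_le_of_ae_le _ ((absolutelyContinuous_toFinite μ).ae_le hnorm))⟩
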